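/- arXiv:2010.06921 — 2 statements merged into one kernel-verified Lean document; each statement's English description precedes it below -/
import Mathlib

section
/- For all x, y ∈ [−1,1]: sup{ |f(x) − f(y)| : f : [−1,1] → ℝ continuous, f(−1) = f(1), f absolutely continuous with |f′(t)| ≤ 1 for almost every t ∈ [−1,1] } = min(|x − y|, 2 − |x − y|). In other words, the metric induced on the circle by the standard Dirac operator via Connes' formula is the arc-length (geodesic) distance on the circle. -/
noncomputable section

open MeasureTheory Set

/-- If `f` is a primitive on `[a, b]` of an integrable `g` with `|g| ≤ 1` almost everywhere, then
`f` is `1`-Lipschitz on `[a, b]`. -/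
theorem abs_sub_le_of_primitive {f g : ℝ → ℝ} {a b c : ℝ} (hc : c ∈ Set.Icc a b)
    (hg : IntegrableOn g (Set.Icc a b))
    (hbound : ∀ᵐ t ∂(volume.restrict (Set.Icc a b)), |g t| ≤ 1)
    (hfg : ∀ z ∈ Set.Icc a b, f z = f c + ∫ t in c..z, g t)
    {u v : ℝ} (hu : u ∈ Set.Icc a b) (hv : v ∈ Set.Icc a b) :
    |f u - f v| ≤ |u - v| := by
  have hint : ∀ z ∈ Set.Icc a b, IntervalIntegrable g volume c z := fun z hz =>
    (hg.mono_set (Set.uIcc_subset_Icc hc hz)).intervalIntegrable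
  rw [hfg u hu, hfg v hv, add_sub_add_left_eq_sub,
    intervalIntegral.integral_interval_sub_left (hint u hu) (hint v hv)]
  rw [ae_restrict_iff' measurableSet_Icc] at hbound
  have h := intervalIntegral.norm_integral_le_of_norm_le_const_ae (a := v) (b := u) (C := 1)
    (f := g) (by
      filter_upwards [hbound] with t ht htm
      exact ht (Set.uIcc_subset_Icc hv hu (Set.uIoc_subset_uIcc htm)))
  simpa using h

/-- The arc-length distance to `y` on the circle of circumference `2` is `1`-Lipschitz in the
coordinate. -/
theorem lipschitzWith_arc_length (y : ℝ) :
    LipschitzWith 1 fun z : ℝ => min |z - y| (2 - |z - y|) := by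
  refine LipschitzWith.of_dist_le_mul fun u v => ?_
  simp only [Real.dist_eq, NNReal.coe_one, one_mul]
  grind

/-- for all `x, y ∈ [−1,1]`, the supremum of `|f(x) − f(y)|` over all continuous
`f : [−1,1] → ℝ` with `f(−1) = f(1)` which are absolutely continuous with `|f′(t)| ≤ 1` for
a.e. `t ∈ [−1,1]` equals `min(|x − y|, 2 − |x − y|)`: the metric induced on the circle by the
standard Dirac operator via Connes' formula is the arc-length (geodesic) distance. -/
theorem connes_dist_circle_eq_arc_length
    (x : ℝ) (hx : x ∈ Set.Icc (-1 : ℝ) 1) (y : ℝ) (hy : y ∈ Set.Icc (-1 : ℝ) 1) :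
    sSup { r : ℝ | ∃ f g : ℝ → ℝ,
        ContinuousOn f (Set.Icc (-1 : ℝ) 1) ∧
        f (-1) = f 1 ∧
        IntegrableOn g (Set.Icc (-1 : ℝ) 1) ∧
        (∀ᵐ t ∂(volume.restrict (Set.Icc (-1 : ℝ) 1)), |g t| ≤ 1) ∧
        (∀ z ∈ Set.Icc (-1 : ℝ) 1, f z = f 0 + ∫ t in (0 : ℝ)..z, g t) ∧
        r = |f x - f y| }
      = min |x - y| (2 - |x - y|) := by
  refine IsGreatest.csSup_eq ⟨?_, ?_⟩
  · have hlip := lipschitzWith_arc_length y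
    have hac : ∀ a b : ℝ, AbsolutelyContinuousOnInterval
        (fun z : ℝ => min |z - y| (2 - |z - y|)) a b := fun a b =>
      hlip.lipschitzOnWith.absolutelyContinuousOnInterval
    refine ⟨_, deriv fun z : ℝ => min |z - y| (2 - |z - y|),
      hlip.continuous.continuousOn, ?_, ?_, ?_, fun z _ => ?_, ?_⟩
    · grind
    · exact (intervalIntegrable_iff_integrableOn_Icc_of_le (by norm_num)).1
        (hac (-1) 1).intervalIntegrable_deriv
    · exact Filter.Eventually.of_forall fun t => by
        simpa using norm_deriv_le_of_lipschitz (x₀ := t) hlip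
    · rw [(hac 0 z).integral_deriv_eq_sub]
      ring
    · grind
  · rintro r ⟨f, g, -, hper, hg, hbound, hfg, rfl⟩
    have hf : ∀ u ∈ Set.Icc (-1 : ℝ) 1, ∀ v ∈ Set.Icc (-1 : ℝ) 1, |f u - f v| ≤ |u - v| :=
      fun u hu v hv => abs_sub_le_of_primitive (by norm_num) hg hbound hfg hu hv
    have hl : (-1 : ℝ) ∈ Set.Icc (-1 : ℝ) 1 := by norm_num
    have hr : (1 : ℝ) ∈ Set.Icc (-1 : ℝ) 1 := by norm_num
    have hxy := hf x hx y hy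
    have hxl := hf x hx _ hl
    have hxr := hf x hx _ hr
    have hyl := hf y hy _ hl
    have hyr := hf y hy _ hr
    refine le_min hxy ?_
    grind
end
end

section
/- Let p ≥ 1, B ∈ ℕ, and for j ∈ {0,…,B} let C_j : [0,1] → ℝ^p be continuous and injective with finite length λ_j > 0. Let X = ⋃_{j=0}^{B} ran(C_j), assume X is path-connected, let V = { C_j(0), C_j(1) : j ∈ {0,…,B} } be the set of endpoints, and let d be the geodesic distance on X. Assume: (a) ran(C_j) ∩ ran(C_k) ⊆ V for all j ≠ k; (b) each C_j is a geodesic of (X, d), i.e., d(C_j(s), C_j(t)) = λ_j·|s − t| for all s, t ∈ [0,1]. Then for every f : X → ℂ and every K ≥ 0: f is K-Lipschitz with respect to d if and only if |f(C_j(s)) − f(C_j(t))| ≤ K·λ_j·|s − t| for every j ∈ {0,…,B} and all s, t ∈ [0,1]. -/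
noncomputable section

open Set

/-- The geodesic distance on a subset `S ⊆ ℝ^p`: the infimum of the lengths (total variations
on `[0,1]`) of continuous curves in `S` joining `x` to `y`, valued in `[0,∞]`. -/
def geoDistE {p : ℕ} (S : Set (EuclideanSpace ℝ (Fin p)))
    (x y : EuclideanSpace ℝ (Fin p)) : ENNReal :=
  ⨅ (γ : ℝ → EuclideanSpace ℝ (Fin p)) (_ : ContinuousOn γ (Set.Icc 0 1))
    (_ : Set.MapsTo γ (Set.Icc 0 1) S) (_ : γ 0 = x) (_ : γ 1 = y),
    eVariationOn γ (Set.Icc 0 1)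

/-- A local-to-global estimate: if an interval is covered by finitely many closed sets and the
distances between values of `g` at points of a common set are bounded by a superadditive `M`,
then so is the distance between the values at the end points. -/
theorem edist_le_of_finite_closed_cover {ι α : Type*} [DecidableEq ι] [PseudoEMetricSpace α]
    (g : ℝ → α) (M : ℝ → ℝ → ENNReal) (A : ι → Set ℝ) (hA : ∀ j, IsClosed (A j)) {b : ℝ}
    (hM : ∀ s t, s ≤ t → t ≤ b → M s t + M t b ≤ M s b)
    (hg : ∀ j, ∀ s ∈ A j, ∀ t ∈ A j, s ≤ t → edist (g s) (g t) ≤ M s t)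
    (F : Finset ι) (a : ℝ) (hab : a ≤ b) (hF : Icc a b ⊆ ⋃ j ∈ F, A j) :
    edist (g a) (g b) ≤ M a b := by
  induction F using Finset.strongInduction generalizing a with
  | H F ih =>
    obtain ⟨j, hj, haj⟩ := mem_iUnion₂.1 (hF (left_mem_Icc.2 hab))
    obtain ⟨t, ⟨htj, hat, htb⟩, hmax⟩ :=
      (isCompact_Icc.inter_left (hA j)).exists_isGreatest ⟨a, haj, left_mem_Icc.2 hab⟩
    rcases htb.eq_or_lt with rfl | htb'
    · exact hg j a haj t htj hab
    have hIoc : Ioc t b ⊆ ⋃ k ∈ F.erase j, A k := by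
      intro u hu
      have hu' : u ∈ Icc a b := ⟨hat.trans hu.1.le, hu.2⟩
      obtain ⟨k, hk, huk⟩ := mem_iUnion₂.1 (hF hu')
      refine mem_iUnion₂.2 ⟨k, Finset.mem_erase.2 ⟨?_, hk⟩, huk⟩
      rintro rfl
      exact hu.1.not_ge (hmax ⟨huk, hu'⟩)
    have hIcc : Icc t b ⊆ ⋃ k ∈ F.erase j, A k := by
      rw [← closure_Ioc htb'.ne]
      exact closure_minimal hIoc ((F.erase j).finite_toSet.isClosed_biUnion fun k _ => hA k)
    calc edist (g a) (g b) ≤ edist (g a) (g t) + edist (g t) (g b) := edist_triangle _ _ _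
      _ ≤ M a t + M t b :=
        add_le_add (hg j a haj t htj hat) (ih _ (Finset.erase_ssubset hj) t htb hIcc)
      _ ≤ M a b := hM a t hat htb

/-- The geodesic distance between two points of a curve is at most the length of the arc
between them. -/
theorem geoDistE_le_eVariationOn {p : ℕ} {S : Set (EuclideanSpace ℝ (Fin p))}
    {γ : ℝ → EuclideanSpace ℝ (Fin p)} {s t : ℝ} (hst : s ≤ t)
    (hγ : ContinuousOn γ (Icc s t)) (hS : MapsTo γ (Icc s t) S) :
    geoDistE S (γ s) (γ t) ≤ eVariationOn γ (Icc s t) := by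
  set φ : ℝ → ℝ := fun u => s + u * (t - s) with hφ
  have hmaps : MapsTo φ (Icc 0 1) (Icc s t) := fun u hu =>
    ⟨by have := mul_nonneg hu.1 (sub_nonneg.2 hst); simp only [hφ]; linarith,
      by have := mul_le_mul_of_nonneg_right hu.2 (sub_nonneg.2 hst); simp only [hφ]; linarith⟩
  have hmono : MonotoneOn φ (Icc 0 1) := fun u _ v _ huv => by
    have := mul_le_mul_of_nonneg_right huv (sub_nonneg.2 hst)
    simp only [hφ]
    linarith
  refine le_trans ?_ (eVariationOn.comp_le_of_monotoneOn γ φ hmono hmaps)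
  refine iInf_le_of_le (γ ∘ φ) <|
    iInf_le_of_le (hγ.comp (by simp only [hφ]; fun_prop) hmaps) <|
    iInf_le_of_le (hS.comp hmaps) <| iInf_le_of_le ?_ <| iInf_le_of_le ?_ le_rfl <;>
  simp [hφ]

/-- let `p ≥ 1`, `B ∈ ℕ`, and for `j ∈ {0,…,B}` let `C_j : [0,1] → ℝ^p` be
continuous and injective with finite length `λ_j > 0`.  Let `X = ⋃_j ran(C_j)` be
path-connected, `V` the set of endpoints, `d` the geodesic distance on `X`.  Assume (a)
`ran(C_j) ∩ ran(C_k) ⊆ V` for `j ≠ k`; (b) each `C_j` is a geodesic of `(X, d)`, i.e.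
`d(C_j(s), C_j(t)) = λ_j |s − t|`.  Then for every `f : X → ℂ` and `K ≥ 0`: `f` is
`K`-Lipschitz for `d` iff `|f(C_j(s)) − f(C_j(t))| ≤ K λ_j |s − t|` for every `j` and all
`s, t ∈ [0,1]`. -/
theorem lipschitz_iff_lipschitz_on_each_curve
    (p : ℕ) (hp : 1 ≤ p) (B : ℕ)
    (C : Fin (B + 1) → ℝ → EuclideanSpace ℝ (Fin p))
    (lam : Fin (B + 1) → ℝ) (hlam : ∀ j, 0 < lam j)
    (hCcont : ∀ j, ContinuousOn (C j) (Set.Icc 0 1))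
    (hCinj : ∀ j, Set.InjOn (C j) (Set.Icc 0 1))
    (hClen : ∀ j, eVariationOn (C j) (Set.Icc 0 1) = ENNReal.ofReal (lam j))
    (hconn : IsPathConnected (⋃ j, C j '' Set.Icc 0 1))
    (hV : ∀ j k : Fin (B + 1), j ≠ k →
      (C j '' Set.Icc 0 1) ∩ (C k '' Set.Icc 0 1) ⊆
        { x | ∃ i : Fin (B + 1), C i 0 = x ∨ C i 1 = x })
    (hgeo : ∀ j : Fin (B + 1), ∀ s ∈ Set.Icc (0 : ℝ) 1, ∀ t ∈ Set.Icc (0 : ℝ) 1,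
      geoDistE (⋃ i, C i '' Set.Icc 0 1) (C j s) (C j t) = ENNReal.ofReal (lam j * |s - t|))
    (f : EuclideanSpace ℝ (Fin p) → ℂ) (K : ℝ) (hK : 0 ≤ K) :
    (∀ x ∈ ⋃ i, C i '' Set.Icc 0 1, ∀ y ∈ ⋃ i, C i '' Set.Icc 0 1,
        ENNReal.ofReal ‖f x - f y‖ ≤
          ENNReal.ofReal K * geoDistE (⋃ i, C i '' Set.Icc 0 1) x y) ↔
      (∀ j : Fin (B + 1), ∀ s ∈ Set.Icc (0 : ℝ) 1, ∀ t ∈ Set.Icc (0 : ℝ) 1,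
        ‖f (C j s) - f (C j t)‖ ≤ K * lam j * |s - t|) := by
  have hmem : ∀ j, ∀ s ∈ Icc (0 : ℝ) 1, C j s ∈ ⋃ i, C i '' Icc 0 1 := fun j s hs =>
    mem_iUnion.2 ⟨j, s, hs, rfl⟩
  constructor
  · intro h j s hs t ht
    have hd := h _ (hmem j s hs) _ (hmem j t ht)
    have hnn : 0 ≤ lam j * |s - t| := mul_nonneg (hlam j).le (abs_nonneg _)
    rw [hgeo j s hs t ht, ← ENNReal.ofReal_mul hK,
      ENNReal.ofReal_le_ofReal_iff (mul_nonneg hK hnn), ← mul_assoc] at hd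
    exact hd
  · intro h x hx y hy
    have hcurve : ∀ γ : ℝ → EuclideanSpace ℝ (Fin p), ContinuousOn γ (Icc 0 1) →
        MapsTo γ (Icc 0 1) (⋃ i, C i '' Icc 0 1) →
        ENNReal.ofReal ‖f (γ 0) - f (γ 1)‖ ≤
          ENNReal.ofReal K * eVariationOn γ (Icc 0 1) := by
      intro γ hγ hγX
      rw [← dist_eq_norm, ← edist_dist]
      refine edist_le_of_finite_closed_cover (fun u => f (γ u))
        (fun s t => ENNReal.ofReal K * eVariationOn γ (Icc s t))
        (fun j => Icc 0 1 ∩ γ ⁻¹' (C j '' Icc 0 1))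
        (fun j => hγ.preimage_isClosed_of_isClosed isClosed_Icc
          (isCompact_Icc.image_of_continuousOn (hCcont j)).isClosed)
        ?_ ?_ Finset.univ 0 zero_le_one ?_
      · intro s t hst ht
        have := eVariationOn.Icc_add_Icc γ (s := univ) hst ht (mem_univ t)
        simp only [univ_inter] at this
        rw [← mul_add, this]
      · rintro j s ⟨hs, u, hu, hus⟩ t ⟨ht, v, hv, hvt⟩ hst
        have hsub : Icc s t ⊆ Icc 0 1 := Icc_subset_Icc hs.1 ht.2
        calc edist (f (γ s)) (f (γ t)) = ENNReal.ofReal ‖f (C j u) - f (C j v)‖ := by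
              rw [edist_dist, dist_eq_norm, hus, hvt]
          _ ≤ ENNReal.ofReal (K * (lam j * |u - v|)) :=
              ENNReal.ofReal_le_ofReal ((h j u hu v hv).trans_eq (mul_assoc _ _ _))
          _ = ENNReal.ofReal K * geoDistE (⋃ i, C i '' Icc 0 1) (γ s) (γ t) := by
              rw [ENNReal.ofReal_mul hK, ← hgeo j u hu v hv, hus, hvt]
          _ ≤ ENNReal.ofReal K * eVariationOn γ (Icc s t) := by
              gcongr
              exact geoDistE_le_eVariationOn hst (hγ.mono hsub) (hγX.mono_left hsub)
      · intro u hu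
        obtain ⟨j, hj⟩ := mem_iUnion.1 (hγX hu)
        exact mem_iUnion₂.2 ⟨j, Finset.mem_univ j, hu, hj⟩
    rcases hK.eq_or_lt with rfl | hK'
    · obtain ⟨γ, hγ⟩ := hconn.joinedIn x hx y hy
      have := hcurve γ.extend γ.continuous_extend.continuousOn fun u hu => by
        rw [γ.extend_apply hu]
        exact hγ _
      simpa using this
    · have hpos : ENNReal.ofReal K ≠ 0 := (ENNReal.ofReal_pos.2 hK').ne'
      simp only [geoDistE, ENNReal.mul_iInf_of_ne hpos ENNReal.ofReal_ne_top, le_iInf_iff]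
      rintro γ hγ hγX rfl rfl
      exact hcurve γ hγ hγX
end
end
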